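/- Let n ≥ 3, let an oriented graph with m edges on Fin n be given by head/tail maps h, t : Fin m → Fin n with h k ≠ t k, and let H be its transposed incidence matrix with rank H = n − 1. Fix target distances d : Fin m → ℝ and a mismatch vector μ : Fin m → ℝ. Let x : Fin n → (Fin 2 → ℝ) be a multi-point with edge vectors z, error vector e, rigidity matrix R and matrix S as in the framework setup, and suppose rank R = 2n − 3. Assume R Rᵀ e = R Sᵀ μ (i.e. the error derivative vanishes at x along the overall system). Let v̄ = (1/n) Σᵢ x i, and let w : Fin m → ℝ be defined by w k = (x (h k) − v̄) ∧ (x (t k) − v̄). Then the vector Rᵀ e − Sᵀ μ ∈ ℝ^(Fin n × Fin 2) satisfies: (for every k ∈ Fin m and c ∈ Fin 2, Σᵢ H k i * (Rᵀ e − Sᵀ μ)(i, c) = 0) if and only if Σₖ w k * μ k = 0. -/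

import Mathlib

open Matrix

/-- The wedge product of two vectors in `ℝ²`. -/
def wedge (u v : Fin 2 → ℝ) : ℝ := u 0 * v 1 - u 1 * v 0

/-- The transposed incidence matrix of the oriented graph with head map `h` and tail map `t`. -/
noncomputable def Hmat {n m : ℕ} (h t : Fin m → Fin n) : Matrix (Fin m) (Fin n) ℝ :=
  fun k i => if i = h k then 1 else if i = t k then -1 else 0

/-- The edge vectors `z k = x (h k) − x (t k)` of a multi-point `x`. -/
noncomputable def edgeVec {n m : ℕ} (h t : Fin m → Fin n) (x : Fin n → Fin 2 → ℝ) :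
    Fin m → Fin 2 → ℝ :=
  fun k => x (h k) - x (t k)

/-- The rigidity matrix `R k (i, c) = H k i * (z k) c`. -/
noncomputable def rigidityMat {n m : ℕ} (h t : Fin m → Fin n) (x : Fin n → Fin 2 → ℝ) :
    Matrix (Fin m) (Fin n × Fin 2) ℝ :=
  fun k ic => Hmat h t k ic.1 * edgeVec h t x k ic.2

/-- The matrix `S k (i, c) = (if i = t k then 1 else 0) * (z k) c`. -/
noncomputable def Smat {n m : ℕ} (h t : Fin m → Fin n) (x : Fin n → Fin 2 → ℝ) :
    Matrix (Fin m) (Fin n × Fin 2) ℝ :=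
  fun k ic => (if ic.1 = t k then 1 else 0) * edgeVec h t x k ic.2

theorem sum_Hmat_mul {n m : ℕ} {h t : Fin m → Fin n} {k : Fin m} (hk : h k ≠ t k)
    (f : Fin n → ℝ) : ∑ i, Hmat h t k i * f i = f (h k) - f (t k) := by
  have H : ∀ i, Hmat h t k i * f i =
      (if i = h k then f i else 0) - (if i = t k then f i else 0) := by
    intro i
    unfold Hmat
    by_cases h1 : i = h k
    · simp [h1, hk]
    · by_cases h2 : i = t k <;> simp [h1, h2, hk.symm]
  simp [H, Finset.sum_sub_distrib]

theorem rigidityMat_mulVec {n m : ℕ} {h t : Fin m → Fin n} (x : Fin n → Fin 2 → ℝ)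
    {k : Fin m} (hk : h k ≠ t k) (f : Fin n × Fin 2 → ℝ) :
    (rigidityMat h t x *ᵥ f) k =
      ∑ c, edgeVec h t x k c * (f (h k, c) - f (t k, c)) := by
  simp only [mulVec, dotProduct, rigidityMat, Fintype.sum_prod_type_right]
  refine Finset.sum_congr rfl fun c _ => ?_
  rw [← sum_Hmat_mul hk fun i => f (i, c), Finset.mul_sum]
  exact Finset.sum_congr rfl fun i _ => by ring

theorem Smat_mulVec {n m : ℕ} (h t : Fin m → Fin n) (x : Fin n → Fin 2 → ℝ)
    (k : Fin m) (f : Fin n × Fin 2 → ℝ) :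
    (Smat h t x *ᵥ f) k = ∑ c, edgeVec h t x k c * f (t k, c) := by
  simp [mulVec, dotProduct, Smat, Fintype.sum_prod_type_right]

/-- The infinitesimal rotation of the multi-point `x` about the centre `v`. -/
def rotationField {n : ℕ} (x : Fin n → Fin 2 → ℝ) (v : Fin 2 → ℝ) : Fin n × Fin 2 → ℝ :=
  fun ic => ![-(x ic.1 1 - v 1), x ic.1 0 - v 0] ic.2

/-- The infinitesimal translation in the direction `a`. -/
def translationField (n : ℕ) (a : Fin 2 → ℝ) : Fin n × Fin 2 → ℝ := fun ic => a ic.2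

theorem rigidityMat_mulVec_rotationField {n m : ℕ} {h t : Fin m → Fin n}
    (hht : ∀ k, h k ≠ t k) (x : Fin n → Fin 2 → ℝ) (v : Fin 2 → ℝ) :
    rigidityMat h t x *ᵥ rotationField x v = 0 := by
  ext k
  simp only [rigidityMat_mulVec x (hht k), Fin.sum_univ_two, rotationField, edgeVec]
  simp
  ring

theorem rigidityMat_mulVec_translationField {n m : ℕ} {h t : Fin m → Fin n}
    (hht : ∀ k, h k ≠ t k) (x : Fin n → Fin 2 → ℝ) (a : Fin 2 → ℝ) :
    rigidityMat h t x *ᵥ translationField n a = 0 := by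
  ext k
  simp [rigidityMat_mulVec x (hht k), translationField]

theorem Smat_mulVec_rotationField {n m : ℕ} (h t : Fin m → Fin n)
    (x : Fin n → Fin 2 → ℝ) (v : Fin 2 → ℝ) (k : Fin m) :
    (Smat h t x *ᵥ rotationField x v) k = -wedge (x (h k) - v) (x (t k) - v) := by
  simp only [Smat_mulVec, Fin.sum_univ_two, rotationField, edgeVec, wedge]
  simp
  ring

theorem linearIndependent_translations_rotation {n : ℕ} {x : Fin n → Fin 2 → ℝ}
    (v : Fin 2 → ℝ) {i j : Fin n} (hij : x i ≠ x j) :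
    LinearIndependent ℝ
      ![translationField n ![1, 0], translationField n ![0, 1], rotationField x v] := by
  rw [Fintype.linearIndependent_iff]
  intro g hg
  have h0 : ∀ l, g 0 - g 2 * (x l 1 - v 1) = 0 := fun l => by
    have := congrFun hg (l, 0)
    simp [Fin.sum_univ_three, translationField, rotationField] at this
    linarith
  have h1 : ∀ l, g 1 + g 2 * (x l 0 - v 0) = 0 := fun l => by
    have := congrFun hg (l, 1)
    simp [Fin.sum_univ_three, translationField, rotationField] at this
    linarith
  have h2 : g 2 = 0 := by
    by_contra hne
    refine hij (funext fun c => mul_left_cancel₀ hne ?_)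
    fin_cases c
    · simp only [Fin.zero_eta]
      linarith [h1 i, h1 j]
    · simp only [Fin.mk_one]
      linarith [h0 i, h0 j]
  intro c
  fin_cases c
  · simpa [h2] using h0 i
  · simpa [h2] using h1 i
  · exact h2

/-- In an infinitesimally rigid planar framework, every vector in the kernel of the rigidity
matrix is the sum of an infinitesimal translation and an infinitesimal rotation. -/
theorem exists_eq_translation_add_rotation {n m : ℕ} (hn : 3 ≤ n) {h t : Fin m → Fin n}
    (hht : ∀ k, h k ≠ t k) {x : Fin n → Fin 2 → ℝ}
    (hrank : (rigidityMat h t x).rank = 2 * n - 3) (v : Fin 2 → ℝ) {i j : Fin n}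
    (hij : x i ≠ x j) {u : Fin n × Fin 2 → ℝ} (hu : rigidityMat h t x *ᵥ u = 0) :
    ∃ (a : Fin 2 → ℝ) (b : ℝ), u = translationField n a + b • rotationField x v := by
  have hli := linearIndependent_translations_rotation v hij
  have hker : Module.finrank ℝ (LinearMap.ker (rigidityMat h t x).mulVecLin) = 3 := by
    have h1 := (rigidityMat h t x).mulVecLin.finrank_range_add_finrank_ker
    simp only [Module.finrank_fintype_fun_eq_card, Fintype.card_prod, Fintype.card_fin] at h1
    rw [Matrix.rank] at hrank
    omega
  have hspan : Submodule.span ℝ (Set.range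
      ![translationField n ![1, 0], translationField n ![0, 1], rotationField x v]) =
      LinearMap.ker (rigidityMat h t x).mulVecLin := by
    refine Submodule.eq_of_le_of_finrank_eq (Submodule.span_le.2 ?_) ?_
    · rintro _ ⟨c, rfl⟩
      fin_cases c
      · exact rigidityMat_mulVec_translationField hht x ![1, 0]
      · exact rigidityMat_mulVec_translationField hht x ![0, 1]
      · exact rigidityMat_mulVec_rotationField hht x v
    · rw [finrank_span_eq_card hli, hker, Fintype.card_fin]
  have hmem : u ∈ LinearMap.ker (rigidityMat h t x).mulVecLin := hu
  rw [← hspan, Submodule.mem_span_range_iff_exists_fun] at hmem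
  obtain ⟨g, rfl⟩ := hmem
  refine ⟨![g 0, g 1], g 2, ?_⟩
  ext ⟨l, c⟩
  fin_cases c <;> simp [Fin.sum_univ_three, translationField]

theorem exists_edgeVec_ne_zero {n m : ℕ} {h t : Fin m → Fin n} {x : Fin n → Fin 2 → ℝ}
    (hrank : (rigidityMat h t x).rank ≠ 0) : ∃ k, edgeVec h t x k ≠ 0 := by
  by_contra! hz
  refine hrank ?_
  have : rigidityMat h t x = 0 := by
    ext k ic
    simp [rigidityMat, hz k]
  rw [this, Matrix.rank_zero]

theorem rotationField_dotProduct_self_ne_zero {n : ℕ} {x : Fin n → Fin 2 → ℝ}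
    (v : Fin 2 → ℝ) {i j : Fin n} (hij : x i ≠ x j) :
    rotationField x v ⬝ᵥ rotationField x v ≠ 0 := by
  rw [Ne, dotProduct_self_eq_zero]
  intro hz
  have hv : ∀ l, x l = v := fun l => by
    ext c
    have h0 := congrFun hz (l, 0)
    have h1 := congrFun hz (l, 1)
    simp [rotationField] at h0 h1
    fin_cases c
    · simp only [Fin.zero_eta]
      linarith
    · simp only [Fin.mk_one]
      linarith
  exact hij ((hv i).trans (hv j).symm)

/-- Rotations about the centroid are orthogonal to translations. -/
theorem rotationField_dotProduct_translationField {n : ℕ} (hn : n ≠ 0)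
    (x : Fin n → Fin 2 → ℝ) (a : Fin 2 → ℝ) :
    rotationField x ((n : ℝ)⁻¹ • ∑ i, x i) ⬝ᵥ translationField n a = 0 := by
  have hn' : (n : ℝ) ≠ 0 := Nat.cast_ne_zero.2 hn
  simp only [dotProduct, Fintype.sum_prod_type_right, Fin.sum_univ_two, rotationField,
    translationField, ← Finset.sum_mul]
  simp [Finset.sum_apply, mul_inv_cancel_left₀ hn']

/-- Lemma (mismatch criterion): at a state `x` of the overall system where `ė = 0`
(i.e. `R Rᵀ e = R Sᵀ μ`), one has `ż = 0` iff `wᵀ μ = 0`, where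
`w k = (x (h k) − v̄) ∧ (x (t k) − v̄)` and `v̄` is the centroid of the points. -/
theorem stmt3 (n m : ℕ) (hn : 3 ≤ n) (h t : Fin m → Fin n) (hht : ∀ k, h k ≠ t k)
    (hH : (Hmat h t).rank = n - 1)
    (d μ : Fin m → ℝ) (x : Fin n → Fin 2 → ℝ)
    (hrank : (rigidityMat h t x).rank = 2 * n - 3)
    (e : Fin m → ℝ) (he : ∀ k, e k = (∑ c, (edgeVec h t x k c) ^ 2) - (d k) ^ 2)
    (heq : (rigidityMat h t x * (rigidityMat h t x)ᵀ) *ᵥ e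
         = (rigidityMat h t x * (Smat h t x)ᵀ) *ᵥ μ)
    (vbar : Fin 2 → ℝ) (hvbar : vbar = (n : ℝ)⁻¹ • ∑ i, x i)
    (w : Fin m → ℝ) (hw : ∀ k, w k = wedge (x (h k) - vbar) (x (t k) - vbar)) :
    (∀ (k : Fin m) (c : Fin 2),
        ∑ i, Hmat h t k i *
          (((rigidityMat h t x)ᵀ *ᵥ e - (Smat h t x)ᵀ *ᵥ μ) (i, c)) = 0)
      ↔ ∑ k, w k * μ k = 0 := by
  obtain ⟨k₀, hk₀⟩ := exists_edgeVec_ne_zero (h := h) (t := t) (x := x) (by omega)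
  have hij : x (h k₀) ≠ x (t k₀) := sub_ne_zero.1 hk₀
  set u := (rigidityMat h t x)ᵀ *ᵥ e - (Smat h t x)ᵀ *ᵥ μ with hu
  have hRu : rigidityMat h t x *ᵥ u = 0 := by
    rw [hu, mulVec_sub, mulVec_mulVec, mulVec_mulVec, heq, sub_self]
  obtain ⟨a, b, hab⟩ := exists_eq_translation_add_rotation hn hht hrank vbar hij hRu
  have hdot : rotationField x vbar ⬝ᵥ u = ∑ k, w k * μ k := by
    rw [hu, dotProduct_sub, dotProduct_mulVec, dotProduct_mulVec, vecMul_transpose,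
      vecMul_transpose, rigidityMat_mulVec_rotationField hht, zero_dotProduct, zero_sub]
    simp only [dotProduct, Smat_mulVec_rotationField, ← hw, neg_mul, Finset.sum_neg_distrib,
      neg_neg]
  have hself := rotationField_dotProduct_self_ne_zero vbar hij
  have hb : ∑ k, w k * μ k = b * (rotationField x vbar ⬝ᵥ rotationField x vbar) := by
    rw [← hdot, hab, dotProduct_add, dotProduct_smul, smul_eq_mul, hvbar,
      rotationField_dotProduct_translationField (by omega), zero_add]
  rw [hb, mul_eq_zero, or_iff_left hself]
  simp only [fun k c => sum_Hmat_mul (hht k) fun i => u (i, c)]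
  constructor
  · intro hz
    by_contra hne
    have h0 := hz k₀ 0
    have h1 := hz k₀ 1
    simp only [hab, Pi.add_apply, Pi.smul_apply, smul_eq_mul, translationField, rotationField,
      cons_val_zero, cons_val_one] at h0 h1
    refine hij (funext fun c => mul_left_cancel₀ hne ?_)
    fin_cases c
    · simp only [Fin.zero_eta]
      linarith
    · simp only [Fin.mk_one]
      linarith
  · rintro rfl k c
    simp [hab, translationField]
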